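/- arXiv:2004.05799 — 2 statements merged into one kernel-verified Lean document; each statement's English description precedes it below -/
import Mathlib

section
/- For all real p > 1 and q > 1 there exists a constant C(p,q) > 0 such that for all real numbers a > b > 0: (a − b)^{p−1} (a^{q−1} − b^{q−1}) ≥ C(p,q) ( a^{(p+q−2)/p} − b^{(p+q−2)/p} )^{p}. -/
/-- The graph of `x ↦ x ^ p` lies above its tangent line at `m`. -/
theorem rpow_tangent_line_le {p m x : ℝ} (hp : 1 ≤ p) (hm : 0 < m) (hx : 0 ≤ x) :
    m ^ (p - 1) * (p * x - (p - 1) * m) ≤ x ^ p := by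
  have hxm : 0 ≤ x / m := by positivity
  have h := one_add_mul_self_le_rpow_one_add (s := x / m - 1) (by linarith) hp
  rw [add_sub_cancel, Real.div_rpow hx hm.le, le_div_iff₀ (by positivity)] at h
  have hmp : m ^ p = m ^ (p - 1) * m := by
    rw [← Real.rpow_add_one hm.ne', sub_add_cancel]
  calc m ^ (p - 1) * (p * x - (p - 1) * m) = (1 + p * (x / m - 1)) * m ^ p := by
        rw [hmp]; field_simp; ring
    _ ≤ x ^ p := h

/-- A case of Jensen's inequality: the `p`-th power of the mean of `t ^ (s - 1)` over `[b, a]` is at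
most the mean of its `p`-th power `t ^ (r - 1)`. -/
theorem rpow_mean_mul_sub_le {p r s a b : ℝ} (hp : 1 ≤ p) (hr : 0 < r) (hs : 0 < s)
    (hrs : (s - 1) * p = r - 1) (hb : 0 < b) (hab : b < a) :
    ((a ^ s - b ^ s) / s / (a - b)) ^ p * (a - b) ≤ (a ^ r - b ^ r) / r := by
  have hd : 0 < a - b := sub_pos.2 hab
  have hlt : 0 < a ^ s - b ^ s := sub_pos.2 (Real.rpow_lt_rpow hb.le hab hs)
  set m := (a ^ s - b ^ s) / s / (a - b) with hm
  have hm0 : 0 < m := by positivity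
  have hderiv : ∀ t : ℝ, 0 < t → HasDerivAt
      (fun t : ℝ ↦ t ^ r / r - m ^ (p - 1) * (p * (t ^ s / s) - (p - 1) * m * t))
      (t ^ (r - 1) - m ^ (p - 1) * (p * t ^ (s - 1) - (p - 1) * m)) t := by
    intro t ht
    have hpow : ∀ u : ℝ, 0 < u → HasDerivAt (fun t : ℝ ↦ t ^ u / u) (t ^ (u - 1)) t := by
      intro u hu
      exact ((Real.hasDerivAt_rpow_const (p := u) (Or.inl ht.ne')).div_const u).congr_deriv
        (by field_simp)
    exact ((hpow r hr).sub ((((hpow s hs).const_mul p).sub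
      ((hasDerivAt_id t).const_mul ((p - 1) * m))).const_mul (m ^ (p - 1)))).congr_deriv (by ring)
  have hmono : MonotoneOn
      (fun t : ℝ ↦ t ^ r / r - m ^ (p - 1) * (p * (t ^ s / s) - (p - 1) * m * t))
      (Set.Ioi 0) := by
    refine monotoneOn_of_deriv_nonneg (convex_Ioi 0)
      (fun t ht ↦ (hderiv t ht).continuousAt.continuousWithinAt) ?_ ?_
    · intro t ht
      rw [interior_Ioi] at ht
      exact (hderiv t ht).differentiableAt.differentiableWithinAt
    · intro t ht
      rw [interior_Ioi] at ht
      have ht0 : 0 < t := ht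
      rw [(hderiv t ht).deriv, sub_nonneg, ← hrs, Real.rpow_mul ht0.le]
      exact rpow_tangent_line_le hp hm0 (by positivity)
  have h := hmono (Set.mem_Ioi.2 hb) (Set.mem_Ioi.2 (hb.trans hab)) hab.le
  have hmd : a ^ s / s - b ^ s / s = m * (a - b) := by
    rw [hm, div_mul_cancel₀ _ hd.ne', sub_div]
  have hmp : m ^ p = m ^ (p - 1) * m := by
    rw [← Real.rpow_add_one hm0.ne', sub_add_cancel]
  rw [hmp, sub_div]
  linear_combination h - m ^ (p - 1) * p * hmd

/-- For all real `p, q > 1` there is `C(p,q) > 0` such that for all `a > b > 0`: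
`(a-b)^{p-1} (a^{q-1} - b^{q-1}) ≥ C(p,q) (a^{(p+q-2)/p} - b^{(p+q-2)/p})^p`. -/
theorem power_difference_inequality (p q : ℝ) (hp : 1 < p) (hq : 1 < q) :
    ∃ C : ℝ, 0 < C ∧ ∀ a b : ℝ, 0 < b → b < a →
      C * (a ^ ((p + q - 2) / p) - b ^ ((p + q - 2) / p)) ^ p ≤
        (a - b) ^ (p - 1) * (a ^ (q - 1) - b ^ (q - 1)) := by
  have hp0 : 0 < p := by linarith
  have hr : 0 < q - 1 := by linarith
  have hs : 0 < (p + q - 2) / p := div_pos (by linarith) hp0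
  have hrs : ((p + q - 2) / p - 1) * p = q - 1 - 1 := by field_simp; ring
  set s := (p + q - 2) / p
  refine ⟨(q - 1) / s ^ p, by positivity, fun a b hb hab ↦ ?_⟩
  have hd : 0 < a - b := sub_pos.2 hab
  have hlt : 0 < a ^ s - b ^ s := sub_pos.2 (Real.rpow_lt_rpow hb.le hab hs)
  have h := rpow_mean_mul_sub_le hp.le hr hs hrs hb hab
  rw [le_div_iff₀ hr, Real.div_rpow (by positivity) hd.le, Real.div_rpow hlt.le hs.le] at h
  have hdp : (a - b) ^ p = (a - b) ^ (p - 1) * (a - b) := by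
    rw [← Real.rpow_add_one hd.ne', sub_add_cancel]
  calc (q - 1) / s ^ p * (a ^ s - b ^ s) ^ p
      = (a - b) ^ (p - 1) *
          ((a ^ s - b ^ s) ^ p / s ^ p / (a - b) ^ p * (a - b) * (q - 1)) := by
        rw [hdp]; field_simp
    _ ≤ (a - b) ^ (p - 1) * (a ^ (q - 1) - b ^ (q - 1)) := by gcongr
end

section
/- For every real p ≥ 2 there exists a constant C(p) > 0 such that for all real numbers a, b: ( |a|^{p−2} a − |b|^{p−2} b ) (a − b) ≥ C(p) ( |a|^{(p−2)/2} a − |b|^{(p−2)/2} b )^{2}. -/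
/-- Tangent line bound for `x ↦ x ^ (m + 1)` on the nonnegative reals. -/
theorem rpow_mul_self_sub_le {m a b : ℝ} (hm : 0 ≤ m) (hb : 0 ≤ b) (hab : b ≤ a) :
    a ^ m * a - b ^ m * b ≤ (m + 1) * (a ^ m * (a - b)) := by
  rcases (hb.trans hab).eq_or_lt with rfl | ha
  · obtain rfl : b = 0 := le_antisymm hab hb
    simp
  have hpow : ∀ x : ℝ, 0 ≤ x → x ^ m * x = x ^ (m + 1) := fun x hx => by
    rw [Real.rpow_add_of_nonneg hx hm zero_le_one, Real.rpow_one]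
  have hber := one_add_mul_self_le_rpow_one_add (s := b / a - 1)
    (by linarith [div_nonneg hb ha.le]) (p := m + 1) (by linarith)
  rw [add_sub_cancel, Real.div_rpow hb ha.le, ← hpow a ha.le, ← hpow b hb,
    le_div_iff₀ (by positivity)] at hber
  have hcancel : (1 + (m + 1) * (b / a - 1)) * (a ^ m * a)
      = a ^ m * a - (m + 1) * (a ^ m * (a - b)) := by
    field_simp
    ring
  linarith

/-- The power difference inequality for ordered nonnegative reals. -/
theorem rpow_mul_self_sub_sq_le {m a b : ℝ} (hm : 0 ≤ m) (hb : 0 ≤ b) (hab : b ≤ a) :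
    (a ^ m * a - b ^ m * b) ^ 2 ≤
      (m + 1) * (((a ^ m) ^ 2 * a - (b ^ m) ^ 2 * b) * (a - b)) := by
  have ha : 0 ≤ a := hb.trans hab
  have ht : 0 ≤ b ^ m := Real.rpow_nonneg hb m
  have hts : b ^ m ≤ a ^ m := Real.rpow_le_rpow hb hab hm
  have htan := rpow_mul_self_sub_le hm hb hab
  have hnonneg : 0 ≤ a ^ m * a - b ^ m * b :=
    sub_nonneg.2 (mul_le_mul hts hab hb (ht.trans hts))
  have hsq : a ^ m * (a ^ m * a - b ^ m * b) ≤ (a ^ m) ^ 2 * a - (b ^ m) ^ 2 * b := by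
    nlinarith [mul_nonneg (mul_nonneg ht hb) (sub_nonneg.2 hts)]
  calc (a ^ m * a - b ^ m * b) ^ 2
      ≤ (m + 1) * (a ^ m * (a - b)) * (a ^ m * a - b ^ m * b) := by
        rw [sq]
        exact mul_le_mul_of_nonneg_right htan hnonneg
    _ = (m + 1) * (a - b) * (a ^ m * (a ^ m * a - b ^ m * b)) := by ring
    _ ≤ (m + 1) * (a - b) * ((a ^ m) ^ 2 * a - (b ^ m) ^ 2 * b) :=
        mul_le_mul_of_nonneg_left hsq (mul_nonneg (by linarith) (sub_nonneg.2 hab))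
    _ = _ := by ring

/-- The power difference inequality for arbitrary reals. -/
theorem abs_rpow_mul_self_sub_sq_le {m : ℝ} (hm : 0 ≤ m) (a b : ℝ) :
    (|a| ^ m * a - |b| ^ m * b) ^ 2 ≤
      (m + 1) * (((|a| ^ m) ^ 2 * a - (|b| ^ m) ^ 2 * b) * (a - b)) := by
  wlog hab : b ≤ a generalizing a b
  · linarith [this b a (le_of_not_ge hab)]
  rcases le_total 0 b with hb | hb
  · rw [abs_of_nonneg hb, abs_of_nonneg (hb.trans hab)]
    exact rpow_mul_self_sub_sq_le hm hb hab
  rcases le_total a 0 with ha | ha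
  · rw [abs_of_nonpos ha, abs_of_nonpos hb]
    linarith [rpow_mul_self_sub_sq_le hm (neg_nonneg.2 ha) (neg_le_neg hab)]
  · have hopp : (|a| ^ m * a - |b| ^ m * b) ^ 2 ≤
        ((|a| ^ m) ^ 2 * a - (|b| ^ m) ^ 2 * b) * (a - b) := by
      linarith [mul_nonneg (mul_nonneg ha (neg_nonneg.2 hb)) (sq_nonneg (|a| ^ m - |b| ^ m))]
    exact hopp.trans (le_mul_of_one_le_left ((sq_nonneg _).trans hopp) (by linarith))

/-- For every real `p ≥ 2` there is `C(p) > 0` such that for all real `a, b`: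
`(|a|^{p-2}a - |b|^{p-2}b)(a-b) ≥ C(p) (|a|^{(p-2)/2}a - |b|^{(p-2)/2}b)²`,
where `|a|^r a` denotes the odd power (with value `0` at `a = 0`). -/
theorem monotone_power_difference_inequality (p : ℝ) (hp : 2 ≤ p) :
    ∃ C : ℝ, 0 < C ∧ ∀ a b : ℝ,
      C * (|a| ^ ((p - 2) / 2) * a - |b| ^ ((p - 2) / 2) * b) ^ (2 : ℕ) ≤
        (|a| ^ (p - 2) * a - |b| ^ (p - 2) * b) * (a - b) := by
  have hm : 0 ≤ (p - 2) / 2 := by linarith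
  have hsq : ∀ x : ℝ, |x| ^ (p - 2) = (|x| ^ ((p - 2) / 2)) ^ 2 := fun x => by
    rw [← Real.rpow_mul_natCast (abs_nonneg x)]
    congr 1
    push_cast
    ring
  refine ⟨((p - 2) / 2 + 1)⁻¹, by positivity, fun a b => ?_⟩
  rw [hsq a, hsq b, inv_mul_le_iff₀ (by positivity)]
  exact abs_rpow_mul_self_sub_sq_le hm a b
end
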